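/- Let (v; w₀, …, w_{n−1}) be an embedded, immersed simplicial vertex star in ℝ³ whose Gauss image has no self-intersections and whose discrete Gaussian curvature K(v) is positive. Then the Gauss image is contained in an open hemisphere: there exists a unit vector ν such that ⟨nᵢ, ν⟩ > 0 for all i. (Claim following Proposition 2.13: for positively curved vertices with non-self-intersecting Gauss image, containment in an open hemisphere — and hence the existence of a transverse plane — is automatic.) -/

import Mathlib

open RealInnerProductSpace

noncomputable section

/-- Euclidean 3-space. -/
abbrev E3 : Type := EuclideanSpace ℝ (Fin 3)

/-- The cross product on `E3`. -/
noncomputable def cross3 (a b : E3) : E3 :=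
  (WithLp.equiv 2 (Fin 3 → ℝ)).symm
    ![a 1 * b 2 - a 2 * b 1, a 2 * b 0 - a 0 * b 2, a 0 * b 1 - a 1 * b 0]

/-- The face `Tᵢ = conv {v, wᵢ, wᵢ₊₁}` of a simplicial vertex star `(v; w)`;
indices are taken modulo `n`. -/
def starFace {n : ℕ} (v : E3) (w : ZMod n → E3) (i : ZMod n) : Set E3 :=
  convexHull ℝ {v, w i, w (i + 1)}

/-- The unnormalized face normal `mᵢ = (wᵢ − v) × (wᵢ₊₁ − v)`. -/
noncomputable def starFN {n : ℕ} (v : E3) (w : ZMod n → E3) (i : ZMod n) : E3 :=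
  cross3 (w i - v) (w (i + 1) - v)

/-- The unit face normal `nᵢ = mᵢ / ‖mᵢ‖`. -/
noncomputable def starUN {n : ℕ} (v : E3) (w : ZMod n → E3) (i : ZMod n) : E3 :=
  ‖starFN v w i‖⁻¹ • starFN v w i

/-- `(v; w₀, …, w_{n−1})` is an embedded, immersed simplicial vertex star:
`n ≥ 3`; consecutive edge vectors are linearly independent; distinct faces meet
exactly in their common edge (adjacent case) or in `{v}` (non-adjacent case);
and consecutive unit normals satisfy `nᵢ₊₁ ≠ ±nᵢ`. -/
def IsStar {n : ℕ} (v : E3) (w : ZMod n → E3) : Prop :=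
  3 ≤ n ∧
  (∀ i : ZMod n, LinearIndependent ℝ ![w i - v, w (i + 1) - v]) ∧
  (∀ i : ZMod n, starUN v w (i + 1) ≠ starUN v w i ∧ starUN v w (i + 1) ≠ -starUN v w i) ∧
  (∀ i j : ZMod n, i ≠ j →
    (j = i + 1 → starFace v w i ∩ starFace v w j = segment ℝ v (w j)) ∧
    (i = j + 1 → starFace v w i ∩ starFace v w j = segment ℝ v (w i)) ∧
    (j ≠ i + 1 → i ≠ j + 1 → starFace v w i ∩ starFace v w j = {v}))

/-- The shorter great-circle arc `Arc(p, q)` joining two unit vectors `p ≠ ±q`. -/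
def sArc (p q : E3) : Set E3 :=
  {x | ∃ s t : ℝ, 0 ≤ s ∧ 0 ≤ t ∧ 0 < s + t ∧ x = ‖s • p + t • q‖⁻¹ • (s • p + t • q)}

/-- The Gauss image of the vertex star (the spherical polygon with vertices `nᵢ` and
edges `Arc(nᵢ, nᵢ₊₁)`) has no self-intersections. -/
def GaussEmb {n : ℕ} (v : E3) (w : ZMod n → E3) : Prop :=
  Function.Injective (starUN v w) ∧
  ∀ i j : ZMod n, i ≠ j →
    (j = i + 1 →
      sArc (starUN v w i) (starUN v w (i + 1)) ∩ sArc (starUN v w j) (starUN v w (j + 1)) =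
        {starUN v w j}) ∧
    (i = j + 1 →
      sArc (starUN v w i) (starUN v w (i + 1)) ∩ sArc (starUN v w j) (starUN v w (j + 1)) =
        {starUN v w i}) ∧
    (j ≠ i + 1 → i ≠ j + 1 →
      sArc (starUN v w i) (starUN v w (i + 1)) ∩ sArc (starUN v w j) (starUN v w (j + 1)) = ∅)

/-- The discrete Gaussian curvature (angle defect)
`K(v) = 2π − Σᵢ ∠(wᵢ − v, wᵢ₊₁ − v)`. -/
noncomputable def curv {n : ℕ} [NeZero n] (v : E3) (w : ZMod n → E3) : ℝ :=
  2 * Real.pi - ∑ i : ZMod n, InnerProductGeometry.angle (w i - v) (w (i + 1) - v)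

/-- The face `Tᵢ` is an inflection face: its two neighboring faces lie strictly on
opposite sides of its plane. -/
def IsInflectionFace {n : ℕ} (v : E3) (w : ZMod n → E3) (i : ZMod n) : Prop :=
  ⟪w (i - 1) - v, starFN v w i⟫ * ⟪w (i + 2) - v, starFN v w i⟫ < 0

/-- The carrier `Star = ⋃ᵢ Tᵢ` of the vertex star. -/
def starCarrier {n : ℕ} (v : E3) (w : ZMod n → E3) : Set E3 :=
  ⋃ i : ZMod n, starFace v w i

/-! ### Planar part: a discrete version of Hopf's Umlaufsatz argument -/

lemma arg_div_of_mem {z w : ℂ} (hz : z ≠ 0) (hw : w ≠ 0)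
    (h1 : -Real.pi < w.arg - z.arg) (h2 : w.arg - z.arg ≤ Real.pi) :
    (w / z).arg = w.arg - z.arg := by
  have h := Complex.arg_div_coe_angle hw hz
  rw [← Real.Angle.coe_sub] at h
  have h3 := congrArg Real.Angle.toReal h
  rwa [Complex.arg_coe_angle_toReal_eq_arg, Real.Angle.toReal_coe_eq_self_iff.2 ⟨h1, h2⟩] at h3

lemma arg_div_open {z w c : ℂ} (hz : 0 < (z / c).re) (hw : 0 < (w / c).re) :
    (w / z).arg = (w / c).arg - (z / c).arg := by
  have hz0 : z / c ≠ 0 := by intro h; simp [h] at hz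
  have hw0 : w / c ≠ 0 := by intro h; simp [h] at hw
  have hc : c ≠ 0 := by rintro rfl; simp at hz
  have hzp := Complex.abs_arg_lt_pi_div_two_iff.2 (Or.inl hz)
  have hwp := Complex.abs_arg_lt_pi_div_two_iff.2 (Or.inl hw)
  rw [abs_lt] at hzp hwp
  rw [← arg_div_of_mem hz0 hw0 (by linarith) (by linarith), div_div_div_cancel_right₀ hc]

lemma arg_div_closed {z w c : ℂ} (hc : c ≠ 0) (hz : 0 ≤ (z / c).re) (hw : 0 ≤ (w / c).re)
    (h0 : (0 : ℂ) ∉ segment ℝ z w) :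
    (w / z).arg = (w / c).arg - (z / c).arg := by
  have hzz : z ≠ 0 := by rintro rfl; exact h0 (left_mem_segment ℝ _ _)
  have hww : w ≠ 0 := by rintro rfl; exact h0 (right_mem_segment ℝ _ _)
  have hz0 : z / c ≠ 0 := div_ne_zero hzz hc
  have hw0 : w / c ≠ 0 := div_ne_zero hww hc
  have hzp := Complex.abs_arg_le_pi_div_two_iff.2 hz
  have hwp := Complex.abs_arg_le_pi_div_two_iff.2 hw
  rw [abs_le] at hzp hwp
  by_cases hne : (w / c).arg - (z / c).arg = -Real.pi
  · exfalso
    have h := Complex.arg_div_coe_angle hw0 hz0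
    rw [← Real.Angle.coe_sub, hne, div_div_div_cancel_right₀ hc] at h
    have h3 := congrArg Real.Angle.toReal h
    rw [Complex.arg_coe_angle_toReal_eq_arg] at h3
    simp only [Real.Angle.coe_neg, Real.Angle.neg_coe_pi, Real.Angle.toReal_pi] at h3
    rw [Complex.arg_eq_pi_iff] at h3
    obtain ⟨hre, him⟩ := h3
    set r := (w / z).re with hr
    have hwz : w = (r : ℂ) * z := by
      have : w / z = (r : ℂ) := Complex.ext (by simp [hr]) (by simp [him])
      rw [← this, div_mul_cancel₀ _ hzz]
    apply h0
    refine ⟨-r / (1 - r), 1 / (1 - r), by apply div_nonneg <;> linarith,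
      by apply div_nonneg <;> linarith, by field_simp [show (1 - r) ≠ 0 by linarith]; ring, ?_⟩
    rw [hwz]
    have : ((1 : ℂ) - r) ≠ 0 := by
      have h : (1 - r) ≠ 0 := by linarith
      exact_mod_cast h
    simp only [Complex.real_smul]
    push_cast
    field_simp
    ring
  · rw [← arg_div_of_mem hz0 hw0 (lt_of_le_of_ne (by linarith) (Ne.symm hne)) (by linarith),
      div_div_div_cancel_right₀ hc]

/-- Separation of the origin from a compact convex set of complex numbers. -/
lemma exists_halfplane {S : Set ℂ} (hS : Convex ℝ S) (hc : IsCompact S) (h0 : (0 : ℂ) ∉ S) :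
    ∃ c : ℂ, ∀ z ∈ S, 0 < (z / c).re := by
  obtain ⟨f, u, hu, hf⟩ := geometric_hahn_banach_point_closed hS hc.isClosed h0
  rw [map_zero] at hu
  refine ⟨⟨f 1, f Complex.I⟩, fun z hz => ?_⟩
  have h1 : f z = z.re * f 1 + z.im * f Complex.I := by
    conv_lhs => rw [show z = z.re • (1 : ℂ) + z.im • Complex.I by
      simp [Complex.re_add_im]]
    rw [map_add, map_smul, map_smul]; simp
  have h2 : 0 < f z := hu.trans (hf z hz)
  have h3 : 0 < Complex.normSq ⟨f 1, f Complex.I⟩ := by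
    rw [Complex.normSq_pos]
    intro h
    have ha := congrArg Complex.re h
    have hb := congrArg Complex.im h
    simp at ha hb
    rw [h1, ha, hb] at h2
    simp at h2
  rw [Complex.div_re, ← add_div]
  apply div_pos _ h3
  simp only
  linarith

lemma segment_compact (a b : ℂ) : IsCompact (segment ℝ a b) := by
  rw [segment_eq_image ℝ a b]
  exact isCompact_Icc.image (by fun_prop)

open scoped Pointwise in
lemma halfplane_square {a b c d : ℂ} (h : Disjoint (segment ℝ a b) (segment ℝ c d)) :
    ∃ e : ℂ, 0 < ((c - a) / e).re ∧ 0 < ((d - a) / e).re ∧ 0 < ((c - b) / e).re ∧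
      0 < ((d - b) / e).re := by
  obtain ⟨e, he⟩ := exists_halfplane (S := segment ℝ c d - segment ℝ a b)
    ((convex_segment c d).sub (convex_segment a b))
    (by
      rw [← Set.sub_image_prod]
      exact ((segment_compact c d).prod (segment_compact a b)).image continuous_sub) (by
      rintro ⟨x, hx, y, hy, hxy⟩
      rw [sub_eq_zero] at hxy
      subst hxy
      exact Set.disjoint_left.1 h hy hx)
  have la := left_mem_segment ℝ a b
  have lb := right_mem_segment ℝ a b
  have lc := left_mem_segment ℝ c d
  have ld := right_mem_segment ℝ c d
  exact ⟨e, he _ (Set.sub_mem_sub lc la), he _ (Set.sub_mem_sub ld la),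
    he _ (Set.sub_mem_sub lc lb), he _ (Set.sub_mem_sub ld lb)⟩

/-- Exchange of the secant rotation along a square of two disjoint edges. -/
lemma square_rel {a b c d : ℂ} (h : Disjoint (segment ℝ a b) (segment ℝ c d)) :
    ((d - a) / (c - a)).arg - ((d - b) / (c - b)).arg =
      ((c - b) / (c - a)).arg - ((d - b) / (d - a)).arg := by
  obtain ⟨e, h1, h2, h3, h4⟩ := halfplane_square h
  rw [arg_div_open h1 h2, arg_div_open h3 h4, arg_div_open h1 h3, arg_div_open h2 h4]
  ring

lemma triangle_rel {z w : ℂ} (h : (0 : ℂ) ∉ segment ℝ z w) :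
    ((z + w) / z).arg + (w / (z + w)).arg = (w / z).arg := by
  obtain ⟨e, he⟩ := exists_halfplane (convex_segment z w) (segment_compact z w) h
  have h1 := he z (left_mem_segment ℝ _ _)
  have h2 := he w (right_mem_segment ℝ _ _)
  have h3 : 0 < ((z + w) / e).re := by rw [add_div, Complex.add_re]; linarith
  rw [arg_div_open h1 h3, arg_div_open h3 h2, arg_div_open h1 h2]
  ring

lemma not_mem_segment_of_im {z w : ℂ} (h : (w / z).im ≠ 0) : (0 : ℂ) ∉ segment ℝ z w := by
  rintro ⟨s, t, hs, ht, hst, h0⟩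
  have hz : z ≠ 0 := by rintro rfl; simp at h
  have h1 : (s : ℂ) + t * (w / z) = 0 := by
    field_simp
    simpa [mul_comm] using h0
  have h2 := congrArg Complex.im h1
  have h3 := congrArg Complex.re h1
  simp at h2 h3
  rcases h2 with h2 | h2
  · subst h2; simp at h3; subst h3; simp at hst
  · exact h h2

section Planar

variable {n : ℕ}

/-- Turning angle at the vertex `i`. -/
def turnC (q : ZMod n → ℂ) (i : ZMod n) : ℂ := (q (i + 1) - q i) / (q i - q (i - 1))

/-- Total rotation of the secant direction seen from the vertex `i`. -/
def secRot (q : ZMod n → ℂ) (i : ZMod n) : ℝ :=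
  ∑ m ∈ Finset.range (n - 2),
    ((q (i + 2 + (m : ZMod n)) - q i) / (q (i + 1 + (m : ZMod n)) - q i)).arg

lemma natCast_ne_zero' {m : ℕ} (h0 : 0 < m) (h : m < n) : (m : ZMod n) ≠ 0 := by
  rw [Ne, ZMod.natCast_eq_zero_iff]
  intro hd
  exact absurd (Nat.le_of_dvd h0 hd) (by omega)

lemma secRot_step (hn : 3 ≤ n) (q : ZMod n → ℂ)
    (H1 : ∀ i j : ZMod n, i ≠ j → j ≠ i + 1 → i ≠ j + 1 →
      Disjoint (segment ℝ (q i) (q (i + 1))) (segment ℝ (q j) (q (j + 1))))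
    (H2 : ∀ i, (turnC q i).im ≠ 0) (i : ZMod n) :
    secRot q i + (turnC q i).arg = secRot q (i + 1) + (turnC q (i + 1)).arg := by
  obtain ⟨k, rfl⟩ : ∃ k, n = k + 3 := ⟨n - 3, by omega⟩
  have hk0 : ((k : ZMod (k + 3)) + 3) = 0 := by
    have := ZMod.natCast_self (k + 3)
    push_cast at this
    exact this
  set B : ℕ → ℝ := fun m =>
    ((q (i + 2 + (m : ZMod (k + 3))) - q (i + 1)) / (q (i + 2 + (m : ZMod (k + 3))) - q i)).arg
    with hB
  have e1 : secRot q i = ((q (i + 2) - q i) / (q (i + 1) - q i)).arg +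
      ∑ m ∈ Finset.range k, ((q (i + 2 + ((m + 1 : ℕ) : ZMod (k + 3))) - q i) /
        (q (i + 2 + (m : ZMod (k + 3))) - q i)).arg := by
    unfold secRot
    rw [show k + 3 - 2 = k + 1 by omega, Finset.sum_range_succ', add_comm]
    simp only [Nat.cast_zero, add_zero]
    congr 1
    refine Finset.sum_congr rfl fun m _ => ?_
    push_cast
    ring_nf
  have e2 : secRot q (i + 1) =
      ∑ m ∈ Finset.range k, ((q (i + 2 + ((m + 1 : ℕ) : ZMod (k + 3))) - q (i + 1)) /
        (q (i + 2 + (m : ZMod (k + 3))) - q (i + 1))).arg +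
      ((q i - q (i + 1)) / (q (i - 1) - q (i + 1))).arg := by
    unfold secRot
    rw [show k + 3 - 2 = k + 1 by omega, Finset.sum_range_succ]
    congr 1
    · refine Finset.sum_congr rfl fun m _ => ?_
      push_cast
      ring_nf
    · have a1 : i + 1 + 2 + (k : ZMod (k + 3)) = i := by linear_combination hk0
      have a2 : i + 1 + 1 + (k : ZMod (k + 3)) = i - 1 := by linear_combination hk0
      rw [a1, a2]
  have e3 : ∑ m ∈ Finset.range k, ((q (i + 2 + ((m + 1 : ℕ) : ZMod (k + 3))) - q i) /
        (q (i + 2 + (m : ZMod (k + 3))) - q i)).arg -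
      ∑ m ∈ Finset.range k, ((q (i + 2 + ((m + 1 : ℕ) : ZMod (k + 3))) - q (i + 1)) /
        (q (i + 2 + (m : ZMod (k + 3))) - q (i + 1))).arg = B 0 - B k := by
    rw [← Finset.sum_sub_distrib, ← Finset.sum_range_sub' B]
    refine Finset.sum_congr rfl fun m hm => ?_
    rw [Finset.mem_range] at hm
    have hd := H1 i (i + 2 + (m : ZMod (k + 3))) (by
        intro h
        refine natCast_ne_zero' (n := k + 3) (m := m + 2) (by omega) (by omega) ?_
        push_cast; linear_combination -h) (by
        intro h
        refine natCast_ne_zero' (n := k + 3) (m := m + 1) (by omega) (by omega) ?_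
        push_cast; linear_combination h) (by
        intro h
        refine natCast_ne_zero' (n := k + 3) (m := m + 3) (by omega) (by omega) ?_
        push_cast; linear_combination -h)
    have := square_rel hd
    simp only [hB]
    push_cast
    rw [← add_assoc]
    exact this
  have B0 : B 0 = ((q (i + 2) - q (i + 1)) / (q (i + 2) - q i)).arg := by simp [hB]
  have Bk : B k = ((q (i - 1) - q (i + 1)) / (q (i - 1) - q i)).arg := by
    have a2 : i + 2 + (k : ZMod (k + 3)) = i - 1 := by linear_combination hk0
    simp only [hB, a2]
  have t1 := triangle_rel (not_mem_segment_of_im (H2 (i + 1)))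
  have t2 : ((q (i - 1) - q (i + 1)) / (q (i - 1) - q i)).arg +
      ((q i - q (i + 1)) / (q (i - 1) - q (i + 1))).arg = (turnC q i).arg := by
    have := triangle_rel (not_mem_segment_of_im (H2 i))
    rw [turnC, ← this]
    have r1 : (q i - q (i - 1) + (q (i + 1) - q i)) = -(q (i - 1) - q (i + 1)) := by ring
    rw [r1, ← neg_div_neg_eq (q (i + 1) - q i), ← neg_div_neg_eq (-(q (i - 1) - q (i + 1)))]
    simp only [neg_sub]
  have t1' : ((q (i + 2) - q i) / (q (i + 1) - q i)).arg +
      ((q (i + 2) - q (i + 1)) / (q (i + 2) - q i)).arg = (turnC q (i + 1)).arg := by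
    have r0 : i + 1 + 1 = i + 2 := by ring
    rw [turnC]
    rw [r0, add_sub_cancel_right] at t1 ⊢
    rw [← t1]
    congr 3 <;> ring
  rw [← t1', ← t2, e1, e2]
  rw [B0, Bk] at e3
  linarith

lemma secRot_const [NeZero n] (hn : 3 ≤ n) (q : ZMod n → ℂ)
    (H1 : ∀ i j : ZMod n, i ≠ j → j ≠ i + 1 → i ≠ j + 1 →
      Disjoint (segment ℝ (q i) (q (i + 1))) (segment ℝ (q j) (q (j + 1))))
    (H2 : ∀ i, (turnC q i).im ≠ 0) (i : ZMod n) :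
    secRot q i + (turnC q i).arg = secRot q 0 + (turnC q 0).arg := by
  have : ∀ m : ℕ, secRot q (m : ZMod n) + (turnC q (m : ZMod n)).arg =
      secRot q 0 + (turnC q 0).arg := by
    intro m
    induction m with
    | zero => simp
    | succ m ih => rw [← ih, secRot_step hn q H1 H2 m]; push_cast; rfl
  have h := this i.val
  rwa [ZMod.natCast_zmod_val] at h

/-- At a support vertex the secant rotation plus turning angle is `±π`. -/
lemma secRot_support (hn : 3 ≤ n) (q : ZMod n → ℂ)
    (H1 : ∀ i j : ZMod n, i ≠ j → j ≠ i + 1 → i ≠ j + 1 →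
      Disjoint (segment ℝ (q i) (q (i + 1))) (segment ℝ (q j) (q (j + 1))))
    (H2 : ∀ i, (turnC q i).im ≠ 0) (a : ZMod n) (c : ℂ) (hc : c ≠ 0)
    (hs : ∀ j, 0 ≤ ((q j - q a) / c).re) :
    secRot q a + (turnC q a).arg = if 0 < (turnC q a).im then Real.pi else -Real.pi := by
  have hA : secRot q a = ((q (a - 1) - q a) / c).arg - ((q (a + 1) - q a) / c).arg := by
    have e : ∀ m ∈ Finset.range (n - 2),
        ((q (a + 2 + (m : ZMod n)) - q a) / (q (a + 1 + (m : ZMod n)) - q a)).arg =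
        (fun m : ℕ => ((q (a + 1 + (m : ZMod n)) - q a) / c).arg) (m + 1) -
        (fun m : ℕ => ((q (a + 1 + (m : ZMod n)) - q a) / c).arg) m := by
      intro m hm
      rw [Finset.mem_range] at hm
      have a1 : a + 1 + ((m + 1 : ℕ) : ZMod n) = a + 2 + (m : ZMod n) := by push_cast; ring
      simp only [a1]
      apply arg_div_closed hc (hs _) (hs _)
      intro h0
      -- the vertex `a` would lie on the edge
      have hmem : q a ∈ segment ℝ (q (a + 1 + (m : ZMod n))) (q (a + 2 + (m : ZMod n))) := by
        obtain ⟨s, t, h1, h2, h3, h4⟩ := h0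
        refine ⟨s, t, h1, h2, h3, ?_⟩
        have h5 : ((s : ℂ) + t) = 1 := by exact_mod_cast h3
        simp only [Complex.real_smul] at h4 ⊢
        linear_combination h4 + q a * h5
      have a2 : a + 1 + (m : ZMod n) + 1 = a + 2 + (m : ZMod n) := by ring
      rcases Nat.eq_zero_or_pos m with rfl | hm0
      · -- edge `(a+1, a+2)` is adjacent: use the turning at `a + 1`
        simp only [Nat.cast_zero, add_zero] at h0
        have h6 := H2 (a + 1)
        apply h6
        rw [turnC, add_sub_cancel_right, show a + 1 + 1 = a + 2 by ring]
        obtain ⟨s, t, h1, h2, h3, h4⟩ := h0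
        simp only [Complex.real_smul] at h4
        have ht : (t : ℂ) ≠ 0 := by
          intro ht
          have ht' : t = 0 := by exact_mod_cast ht
          have hs' : s = 1 := by linarith
          rw [ht', hs'] at h4
          simp at h4
          apply h6
          rw [turnC, add_sub_cancel_right, h4]; simp
        have hz : q (a + 1) - q a ≠ 0 := by
          intro h; apply h6; rw [turnC, add_sub_cancel_right, h]; simp
        have h5 : ((s : ℂ) + t) = 1 := by exact_mod_cast h3
        have : (q (a + 2) - q (a + 1)) / (q (a + 1) - q a) = (((-1 / t : ℝ)) : ℂ) := by
          push_cast
          field_simp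
          linear_combination h4 - (q (a + 1) - q a) * h5
        rw [this, Complex.ofReal_im]
      · have hd := H1 a (a + 1 + (m : ZMod n)) (by
          intro h
          refine natCast_ne_zero' (n := n) (m := m + 1) (by omega) (by omega) ?_
          push_cast; linear_combination -h) (by
          intro h
          refine natCast_ne_zero' (n := n) (m := m) (by omega) (by omega) ?_
          linear_combination h) (by
          intro h
          refine natCast_ne_zero' (n := n) (m := m + 2) (by omega) (by omega) ?_
          push_cast; linear_combination -h)
        rw [a2] at hd
        exact Set.disjoint_left.1 hd (left_mem_segment ℝ _ _) hmem
    unfold secRot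
    rw [Finset.sum_congr rfl e,
      Finset.sum_range_sub (fun m : ℕ => ((q (a + 1 + (m : ZMod n)) - q a) / c).arg)]
    have a3 : a + 1 + ((n - 2 : ℕ) : ZMod n) = a - 1 := by
      rw [Nat.cast_sub (by omega), ZMod.natCast_self]; push_cast; ring
    simp only [a3, Nat.cast_zero, add_zero]
  have h6 := H2 a
  rw [turnC] at h6
  set z := q (a + 1) - q a with hz
  set y := q (a - 1) - q a with hy
  have hyy : q a - q (a - 1) = -y := by rw [hy]; ring
  rw [hyy, div_neg, Complex.neg_im, neg_ne_zero] at h6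
  have hns : (0 : ℂ) ∉ segment ℝ z y := by
    rw [segment_symm]; exact not_mem_segment_of_im h6
  rw [hA, ← arg_div_closed hc (hs _) (hs _) hns, turnC, ← hz, hyy, div_neg, ← inv_div z y,
    Complex.arg_inv, if_neg (by rw [Complex.arg_eq_pi_iff]; exact fun h => h6 h.2)]
  rw [Complex.neg_im]
  rcases lt_or_gt_of_ne h6 with h | h
  · rw [Complex.arg_neg_eq_arg_add_pi_of_im_neg h, if_pos (by linarith)]; ring
  · rw [Complex.arg_neg_eq_arg_sub_pi_of_im_pos h, if_neg (by linarith)]; ring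

/-- In a simple polygon all support vertices turn in the same direction. -/
lemma support_same [NeZero n] (hn : 3 ≤ n) (q : ZMod n → ℂ)
    (H1 : ∀ i j : ZMod n, i ≠ j → j ≠ i + 1 → i ≠ j + 1 →
      Disjoint (segment ℝ (q i) (q (i + 1))) (segment ℝ (q j) (q (j + 1))))
    (H2 : ∀ i, (turnC q i).im ≠ 0) (a b : ZMod n) (c d : ℂ) (hc : c ≠ 0) (hd : d ≠ 0)
    (hs : ∀ j, 0 ≤ ((q j - q a) / c).re) (ht : ∀ j, 0 ≤ ((q j - q b) / d).re)
    (ha : 0 < (turnC q a).im) : 0 < (turnC q b).im := by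
  have h1 := secRot_support hn q H1 H2 a c hc hs
  have h2 := secRot_support hn q H1 H2 b d hd ht
  rw [secRot_const hn q H1 H2] at h1 h2
  rw [h1, if_pos ha] at h2
  by_contra hb
  rw [if_neg hb] at h2
  linarith [Real.pi_pos]

end Planar

/-! ### Hemisphere lemma -/

lemma exists_mid {u w : E3} (hl : LinearIndependent ℝ ![u, w]) {t : ℝ} (h0 : 0 ≤ t)
    (ht : t ≤ InnerProductGeometry.angle u w) :
    ∃ y : E3, y ≠ 0 ∧ InnerProductGeometry.angle u y = t ∧
      InnerProductGeometry.angle y w = InnerProductGeometry.angle u w - t := by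
  set α := InnerProductGeometry.angle u w with hα
  have hu : u ≠ 0 := by simpa using hl.ne_zero 0
  have hw : w ≠ 0 := by simpa using hl.ne_zero 1
  have hαpi : α ≤ Real.pi := InnerProductGeometry.angle_le_pi _ _
  have hsin : Real.sin α ≠ 0 := by
    intro h
    rw [hα, InnerProductGeometry.sin_eq_zero_iff_angle_eq_zero_or_angle_eq_pi] at h
    rw [LinearIndependent.pair_iff] at hl
    rcases h with h | h
    · rw [InnerProductGeometry.angle_eq_zero_iff] at h
      obtain ⟨_, r, _, hr⟩ := h
      have := hl r (-1) (by rw [hr]; simp)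
      norm_num at this
    · rw [InnerProductGeometry.angle_eq_pi_iff] at h
      obtain ⟨_, r, _, hr⟩ := h
      have := hl r (-1) (by rw [hr]; simp)
      norm_num at this
  have hnu : ‖u‖ ≠ 0 := norm_ne_zero_iff.2 hu
  have hnw : ‖w‖ ≠ 0 := norm_ne_zero_iff.2 hw
  -- normalised versions
  set U : E3 := ‖u‖⁻¹ • u with hU
  set W : E3 := ‖w‖⁻¹ • w with hW
  have hUU : ⟪U, U⟫ = 1 := by
    rw [hU, real_inner_smul_left, real_inner_smul_right, real_inner_self_eq_norm_sq]
    field_simp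
  have hWW : ⟪W, W⟫ = 1 := by
    rw [hW, real_inner_smul_left, real_inner_smul_right, real_inner_self_eq_norm_sq]
    field_simp
  have hUW : ⟪U, W⟫ = Real.cos α := by
    rw [hU, hW, real_inner_smul_left, real_inner_smul_right, hα, InnerProductGeometry.cos_angle]
    field_simp
  have hWU : ⟪W, U⟫ = Real.cos α := by rw [real_inner_comm, hUW]
  clear_value U W
  set V : E3 := (Real.sin α)⁻¹ • (W - Real.cos α • U) with hV
  have hUV : ⟪U, V⟫ = 0 := by
    rw [hV, real_inner_smul_right, inner_sub_right, real_inner_smul_right, hUU, hUW]; ring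
  have hVU : ⟪V, U⟫ = 0 := by rw [real_inner_comm, hUV]
  have hcs := Real.sin_sq_add_cos_sq α
  have hVV : ⟪V, V⟫ = 1 := by
    rw [hV, real_inner_smul_right, real_inner_smul_left, inner_sub_right, inner_sub_left,
      inner_sub_left]
    simp only [real_inner_smul_right, real_inner_smul_left]
    rw [hUU, hWW, hUW, hWU]
    field_simp
    linear_combination -hcs
  have hWe : W = Real.cos α • U + Real.sin α • V := by
    rw [hV, smul_smul, mul_inv_cancel₀ hsin, one_smul]; abel
  set y : E3 := Real.cos t • U + Real.sin t • V with hy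
  have hyy : ⟪y, y⟫ = 1 := by
    rw [hy]
    simp only [inner_add_left, inner_add_right, real_inner_smul_left, real_inner_smul_right,
      hUU, hVV, hUV, hVU]
    linear_combination Real.sin_sq_add_cos_sq t
  have hny : ‖y‖ = 1 := by
    have : ‖y‖ ^ 2 = 1 := by rw [← real_inner_self_eq_norm_sq, hyy]
    nlinarith [norm_nonneg y]
  have hUy : ⟪U, y⟫ = Real.cos t := by
    rw [hy]
    simp only [inner_add_right, real_inner_smul_right, hUU, hUV]; ring
  have hyW : ⟪y, W⟫ = Real.cos (α - t) := by
    rw [hy, hWe]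
    simp only [inner_add_left, inner_add_right, real_inner_smul_left, real_inner_smul_right,
      hUU, hVV, hUV, hVU]
    rw [Real.cos_sub]; ring
  refine ⟨y, by rintro h; rw [h] at hny; simp at hny, ?_, ?_⟩
  · have : InnerProductGeometry.angle u y = InnerProductGeometry.angle U y := by
      rw [hU, InnerProductGeometry.angle_smul_left_of_pos _ _ (by positivity)]
    have hnU : ‖U‖ = 1 := by rw [hU, norm_smul]; simp [hnu]
    rw [this, InnerProductGeometry.angle, hUy, hnU, hny]
    simp [Real.arccos_cos h0 (ht.trans hαpi)]
  · have : InnerProductGeometry.angle y w = InnerProductGeometry.angle y W := by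
      rw [hW, InnerProductGeometry.angle_smul_right_of_pos _ _ (by positivity)]
    have hnW : ‖W‖ = 1 := by rw [hW, norm_smul]; simp [hnw]
    rw [this, InnerProductGeometry.angle, hyW, hnW, hny]
    simp only [mul_one, div_one]
    rw [Real.arccos_cos (by linarith) (by linarith)]

lemma cos_add_cos_pos {a b : ℝ} (ha : 0 ≤ a) (hb : 0 ≤ b) (h : a + b < Real.pi) :
    0 < Real.cos a + Real.cos b := by
  rw [Real.cos_add_cos]
  have h1 : 0 < Real.cos ((a + b) / 2) := Real.cos_pos_of_mem_Ioo ⟨by linarith, by linarith⟩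
  have h2 : 0 < Real.cos ((a - b) / 2) := Real.cos_pos_of_mem_Ioo ⟨by linarith, by linarith⟩
  positivity

lemma inner_pos_of_angles {x y z : E3} (hx : x ≠ 0) (hy : y ≠ 0) (hz : z ≠ 0)
    (h : InnerProductGeometry.angle y x + InnerProductGeometry.angle x z < Real.pi) :
    0 < ⟪‖y‖⁻¹ • y + ‖z‖⁻¹ • z, x⟫ := by
  have h1 := cos_add_cos_pos (InnerProductGeometry.angle_nonneg y x)
    (InnerProductGeometry.angle_nonneg x z) h
  have hx' : 0 < ‖x‖ := norm_pos_iff.2 hx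
  have hy' : 0 < ‖y‖ := norm_pos_iff.2 hy
  have hz' : 0 < ‖z‖ := norm_pos_iff.2 hz
  rw [InnerProductGeometry.cos_angle, InnerProductGeometry.cos_angle] at h1
  rw [inner_add_left, real_inner_smul_left, real_inner_smul_left, real_inner_comm x z]
  have : ‖y‖⁻¹ * ⟪y, x⟫ + ‖z‖⁻¹ * ⟪x, z⟫ = ‖x‖ * (⟪y, x⟫ / (‖y‖ * ‖x‖) + ⟪x, z⟫ / (‖x‖ * ‖z‖)) := by
    field_simp
  rw [this]
  positivity

lemma sum_zmod_range {n : ℕ} [NeZero n] (f : ZMod n → ℝ) :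
    ∑ i : ZMod n, f i = ∑ m ∈ Finset.range n, f (m : ZMod n) := by
  symm
  refine Finset.sum_bij' (fun m _ => (m : ZMod n)) (fun i _ => i.val) ?_ ?_ ?_ ?_ ?_
  · intros; simp
  · intro i _; simp [ZMod.val_lt]
  · intro m hm
    rw [Finset.mem_range] at hm
    exact ZMod.val_cast_of_lt hm
  · intro i _; simp
  · intros; rfl

/-- A closed spherical polygon of length less than `2π` lies in an open hemisphere. -/
lemma exists_hemisphere {n : ℕ} [NeZero n] (u : ZMod n → E3)
    (hl : ∀ i, LinearIndependent ℝ ![u i, u (i + 1)])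
    (hK : ∑ i, InnerProductGeometry.angle (u i) (u (i + 1)) < 2 * Real.pi) :
    ∃ e : E3, ∀ i, 0 < ⟪e, u i⟫ := by
  have hu : ∀ i, u i ≠ 0 := fun i => by simpa using (hl i).ne_zero 0
  rw [sum_zmod_range] at hK
  set S : ℕ → ℝ := fun m => ∑ k ∈ Finset.range m,
    InnerProductGeometry.angle (u (k : ZMod n)) (u ((k : ZMod n) + 1)) with hS
  have hS1 : ∀ m, S (m + 1) = S m +
      InnerProductGeometry.angle (u (m : ZMod n)) (u ((m : ZMod n) + 1)) := by
    intro m; simp only [hS]; rw [Finset.sum_range_succ]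
  have hdist : ∀ a d : ℕ, InnerProductGeometry.angle (u (a : ZMod n)) (u ((a + d : ℕ) : ZMod n)) ≤
      S (a + d) - S a := by
    intro a d
    induction d with
    | zero => simp [InnerProductGeometry.angle_self (hu _)]
    | succ d ih =>
      have h1 := hS1 (a + d)
      have h2 := InnerProductGeometry.angle_le_angle_add_angle (u (a : ZMod n))
        (u ((a + d : ℕ) : ZMod n)) (u ((a + (d + 1) : ℕ) : ZMod n))
      have h3 : ((a + (d + 1) : ℕ) : ZMod n) = ((a + d : ℕ) : ZMod n) + 1 := by push_cast; ring
      rw [h3] at h2 ⊢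
      rw [← add_assoc]
      linarith
  have hdist' : ∀ a b : ℕ, a ≤ b →
      InnerProductGeometry.angle (u (a : ZMod n)) (u (b : ZMod n)) ≤ S b - S a := by
    intro a b hab
    obtain ⟨d, rfl⟩ := Nat.exists_eq_add_of_le hab
    exact hdist a d
  have hL : S n < 2 * Real.pi := hK
  have hL0 : 0 ≤ S n := Finset.sum_nonneg fun _ _ => InnerProductGeometry.angle_nonneg _ _
  have hn : n ≠ 0 := NeZero.ne n
  -- the edge containing the midpoint
  have hex : ∃ m, S n / 2 ≤ S (m + 1) := ⟨n - 1, by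
    rw [Nat.sub_add_cancel (Nat.pos_of_ne_zero hn)]; linarith⟩
  classical
  set k := Nat.find hex with hk
  have hk1 : S n / 2 ≤ S (k + 1) := Nat.find_spec hex
  have hk2 : S k ≤ S n / 2 := by
    rcases Nat.eq_zero_or_pos k with h | h
    · rw [h]; simp only [hS, Finset.range_zero, Finset.sum_empty]; linarith
    · have := Nat.find_min hex (m := k - 1) (by omega)
      rw [Nat.sub_add_cancel h] at this
      linarith
  have hkn : k + 1 ≤ n := by
    have : k ≤ n - 1 := Nat.find_min' hex (by
      rw [Nat.sub_add_cancel (Nat.pos_of_ne_zero hn)]; linarith)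
    omega
  have hk3 := hS1 k
  obtain ⟨y, hy0, hy1, hy2⟩ := exists_mid (hl (k : ZMod n)) (t := S n / 2 - S k) (by linarith)
    (by linarith)
  have h00 : u 0 ≠ 0 := hu 0
  refine ⟨‖u 0‖⁻¹ • u 0 + ‖y‖⁻¹ • y, fun i => inner_pos_of_angles (hu i) h00 hy0 ?_⟩
  have hi : ((i.val : ℕ) : ZMod n) = i := ZMod.natCast_zmod_val i
  have hilt := ZMod.val_lt i
  have hS0 : S 0 = 0 := by simp [hS]
  rw [← hi]
  rcases Nat.lt_or_ge k i.val with h | h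
  · have h1 := hdist' (k + 1) i.val h
    have h2 := hdist' i.val n hilt.le
    rw [ZMod.natCast_self, InnerProductGeometry.angle_comm] at h2
    have h3 := InnerProductGeometry.angle_le_angle_add_angle y (u ((k + 1 : ℕ) : ZMod n))
      (u (i.val : ZMod n))
    rw [InnerProductGeometry.angle_comm y (u (i.val : ZMod n))] at h3
    push_cast at h1 h3
    linarith
  · have h1 := hdist' 0 i.val (Nat.zero_le _)
    have h2 := hdist' i.val k h
    have h3 := InnerProductGeometry.angle_le_angle_add_angle (u (i.val : ZMod n))
      (u (k : ZMod n)) y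
    rw [Nat.cast_zero] at h1
    linarith

/-! ### Three-dimensional part -/

lemma inner3 (x y : E3) : ⟪x, y⟫ = x 0 * y 0 + x 1 * y 1 + x 2 * y 2 := by
  rw [PiLp.inner_apply, Fin.sum_univ_three]
  simp [mul_comm]

@[simp] lemma cross3_0 (a b : E3) : cross3 a b 0 = a 1 * b 2 - a 2 * b 1 := rfl
@[simp] lemma cross3_1 (a b : E3) : cross3 a b 1 = a 2 * b 0 - a 0 * b 2 := rfl
@[simp] lemma cross3_2 (a b : E3) : cross3 a b 2 = a 0 * b 1 - a 1 * b 0 := rfl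

/-- Triple product. -/
def tri (a b c : E3) : ℝ := ⟪a, cross3 b c⟫

lemma tri_eq (a b c : E3) : tri a b c = a 0 * (b 1 * c 2 - b 2 * c 1) +
    a 1 * (b 2 * c 0 - b 0 * c 2) + a 2 * (b 0 * c 1 - b 1 * c 0) := by
  rw [tri, inner3]; simp

lemma ext3 {x y : E3} (h0 : x 0 = y 0) (h1 : x 1 = y 1) (h2 : x 2 = y 2) : x = y := by
  ext i
  fin_cases i
  · exact h0
  · exact h1
  · exact h2

lemma dual_basis (a b c x : E3) : tri a b c • x =
    ⟪x, a⟫ • cross3 b c + ⟪x, b⟫ • cross3 c a + ⟪x, c⟫ • cross3 a b := by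
  apply ext3 <;> simp [tri_eq, inner3] <;> ring

lemma dual_basis' (a b c x : E3) : tri a b c • x =
    ⟪x, cross3 b c⟫ • a + ⟪x, cross3 c a⟫ • b + ⟪x, cross3 a b⟫ • c := by
  apply ext3 <;> simp [tri_eq, inner3] <;> ring

lemma cross3_cross3 (a b c : E3) : cross3 (cross3 a b) (cross3 b c) = tri a b c • b := by
  apply ext3 <;> simp [tri_eq] <;> ring

lemma cross_ne_zero {a b : E3} (h : LinearIndependent ℝ ![a, b]) : cross3 a b ≠ 0 := by
  intro h0
  have ha : a ≠ 0 := by simpa using h.ne_zero 0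
  rw [LinearIndependent.pair_iff] at h
  have e0 : cross3 a b 0 = 0 := by rw [h0]; rfl
  have e1 : cross3 a b 1 = 0 := by rw [h0]; rfl
  have e2 : cross3 a b 2 = 0 := by rw [h0]; rfl
  simp only [cross3_0, cross3_1, cross3_2] at e0 e1 e2
  have key : ∀ i : Fin 3, a i = 0 := by
    intro i
    have := h (b i) (-(a i)) (by
      fin_cases i <;> apply ext3 <;> simp <;> linarith)
    linarith [this.2]
  exact ha (ext3 (key 0) (key 1) (key 2))

lemma cross_smul (r s : ℝ) (a b : E3) : cross3 (r • a) (s • b) = (r * s) • cross3 a b := by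
  apply ext3 <;> simp <;> ring

lemma eq_of_cross_zero {x y : E3} (hx : ‖x‖ = 1) (hy : ‖y‖ = 1) (h : cross3 x y = 0) :
    y = x ∨ y = -x := by
  have hx2 : ⟪x, x⟫ = 1 := by rw [real_inner_self_eq_norm_sq, hx]; norm_num
  have hy2 : ⟪y, y⟫ = 1 := by rw [real_inner_self_eq_norm_sq, hy]; norm_num
  have hc : ⟪cross3 x y, cross3 x y⟫ = ⟪x, x⟫ * ⟪y, y⟫ - ⟪x, y⟫ ^ 2 := by
    simp only [inner3, cross3_0, cross3_1, cross3_2]; ring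
  rw [h, inner_zero_left, hx2, hy2] at hc
  have : ⟪x, y⟫ = 1 ∨ ⟪x, y⟫ = -1 := by
    have h5 : (⟪x, y⟫ - 1) * (⟪x, y⟫ + 1) = 0 := by linear_combination hc
    rcases mul_eq_zero.1 h5 with h6 | h6
    · left; linarith
    · right; linarith
  rcases this with h1 | h1
  · left; exact ((inner_eq_one_iff_of_norm_eq_one hx hy).1 h1).symm
  · right
    have : ⟪x, -y⟫ = 1 := by rw [inner_neg_right, h1]; norm_num
    have := (inner_eq_one_iff_of_norm_eq_one hx (by rwa [norm_neg])).1 this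
    rw [this, neg_neg]

section Spatial

variable {n : ℕ}

lemma faces_cone {v : E3} {w : ZMod n → E3} (i : ZMod n) {a b : ℝ} (ha : 0 ≤ a) (hb : 0 ≤ b)
    (hab : a + b ≤ 1) : v + (a • (w i - v) + b • (w (i + 1) - v)) ∈ starFace v w i := by
  have hc := convex_convexHull ℝ ({v, w i, w (i + 1)} : Set E3)
  have h1 : v ∈ convexHull ℝ ({v, w i, w (i + 1)} : Set E3) := subset_convexHull ℝ _ (by simp)
  have h2 : w i ∈ convexHull ℝ ({v, w i, w (i + 1)} : Set E3) := subset_convexHull ℝ _ (by simp)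
  have h3 : w (i + 1) ∈ convexHull ℝ ({v, w i, w (i + 1)} : Set E3) :=
    subset_convexHull ℝ _ (by simp)
  have := hc.sum_mem (t := Finset.univ) (w := ![1 - a - b, a, b])
    (z := ![v, w i, w (i + 1)]) (by
      intro k _; fin_cases k <;> simp <;> linarith) (by simp [Fin.sum_univ_three]; ring) (by
      intro k _; fin_cases k <;> simp [h1, h2, h3])
  rw [starFace]
  convert this using 1
  simp only [Fin.sum_univ_three, Matrix.cons_val_zero, Matrix.cons_val_one, Matrix.cons_val]
  module

/-- Cones over non-adjacent faces only meet in the origin. -/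
lemma cone_disj {v : E3} {w : ZMod n → E3} (hstar : IsStar v w) {i j : ZMod n} (hij : i ≠ j)
    (h1 : j ≠ i + 1) (h2 : i ≠ j + 1) {a b c d : ℝ} (ha : 0 ≤ a) (hb : 0 ≤ b) (hc : 0 ≤ c)
    (hd : 0 ≤ d)
    (h : a • (w i - v) + b • (w (i + 1) - v) = c • (w j - v) + d • (w (j + 1) - v)) :
    a • (w i - v) + b • (w (i + 1) - v) = 0 := by
  have hI := (hstar.2.2.2 i j hij).2.2 h1 h2
  set r : ℝ := (1 + a + b + c + d)⁻¹ with hr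
  have hpos : 0 < 1 + a + b + c + d := by linarith
  have hr0 : 0 < r := inv_pos.2 hpos
  have hr1 : r * (1 + a + b + c + d) = 1 := inv_mul_cancel₀ hpos.ne'
  have m1 : v + r • (a • (w i - v) + b • (w (i + 1) - v)) ∈ starFace v w i := by
    rw [smul_add, smul_smul, smul_smul]
    exact faces_cone i (by positivity) (by positivity) (by nlinarith)
  have m2 : v + r • (a • (w i - v) + b • (w (i + 1) - v)) ∈ starFace v w j := by
    rw [h, smul_add, smul_smul, smul_smul]
    exact faces_cone j (by positivity) (by positivity) (by nlinarith)
  have m3 : v + r • (a • (w i - v) + b • (w (i + 1) - v)) ∈ ({v} : Set E3) := hI ▸ ⟨m1, m2⟩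
  rw [Set.mem_singleton_iff, add_eq_left, smul_eq_zero] at m3
  exact m3.resolve_left hr0.ne'

lemma starUN_norm {v : E3} {w : ZMod n → E3} (hstar : IsStar v w) (i : ZMod n) :
    ‖starUN v w i‖ = 1 := by
  have : starFN v w i ≠ 0 := cross_ne_zero (hstar.2.1 i)
  rw [starUN, norm_smul, norm_inv, norm_norm, inv_mul_cancel₀ (norm_ne_zero_iff.2 this)]

lemma tri_ne_zero {v : E3} {w : ZMod n → E3} (hstar : IsStar v w) (i : ZMod n) :
    tri (w i - v) (w (i + 1) - v) (w (i + 1 + 1) - v) ≠ 0 := by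
  intro h0
  have h := eq_of_cross_zero (starUN_norm hstar i) (starUN_norm hstar (i + 1)) (by
    rw [starUN, starUN, cross_smul, starFN, starFN, cross3_cross3, h0]; simp)
  rcases h with h | h
  · exact (hstar.2.2.1 i).1 h
  · exact (hstar.2.2.1 i).2 h

/-- Non-adjacent Gauss arcs: their cones do not share a nonzero vector. -/
lemma gauss_disj {v : E3} {w : ZMod n → E3} (hG : GaussEmb v w) {i j : ZMod n} (hij : i ≠ j)
    (h1 : j ≠ i + 1) (h2 : i ≠ j + 1) {a b c d : ℝ} (ha : 0 ≤ a) (hb : 0 ≤ b) (hc : 0 ≤ c)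
    (hd : 0 ≤ d)
    (h : a • starUN v w i + b • starUN v w (i + 1) = c • starUN v w j + d • starUN v w (j + 1)) :
    a • starUN v w i + b • starUN v w (i + 1) = 0 := by
  have hI := (hG.2 i j hij).2.2 h1 h2
  by_contra hne
  have hab : 0 < a + b := by
    rcases (add_nonneg ha hb).lt_or_eq with h | h
    · exact h
    · exfalso; apply hne
      rw [show a = 0 by linarith, show b = 0 by linarith]; simp
  have hcd : 0 < c + d := by
    rcases (add_nonneg hc hd).lt_or_eq with h' | h'
    · exact h'
    · exfalso; apply hne
      rw [h, show c = 0 by linarith, show d = 0 by linarith]; simp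
  set x := a • starUN v w i + b • starUN v w (i + 1) with hx
  have : ‖x‖⁻¹ • x ∈ (∅ : Set E3) := by
    rw [← hI]
    exact ⟨⟨a, b, ha, hb, hab, rfl⟩, ⟨c, d, hc, hd, hcd, by rw [h]⟩⟩
  exact this

end Spatial

section Support

variable {n : ℕ}

lemma gram_det (f g e a b c : E3) :
    ⟪f, a⟫ * (⟪g, b⟫ * ⟪e, c⟫ - ⟪e, b⟫ * ⟪g, c⟫) + ⟪g, a⟫ * (⟪e, b⟫ * ⟪f, c⟫ - ⟪f, b⟫ * ⟪e, c⟫) +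
      ⟪e, a⟫ * (⟪f, b⟫ * ⟪g, c⟫ - ⟪g, b⟫ * ⟪f, c⟫) = tri f g e * tri a b c := by
  simp only [inner3, tri_eq]
  ring

/-- Central projection to a plane. -/
def proj (f g e x : E3) : ℂ := ⟨⟪f, x⟫ / ⟪e, x⟫, ⟪g, x⟫ / ⟪e, x⟫⟩

lemma proj_turn {f g e a b c : E3} (hD : 0 < tri f g e) (ha : 0 < ⟪e, a⟫) (hb : 0 < ⟪e, b⟫)
    (hc : 0 < ⟪e, c⟫) (ht : tri a b c ≠ 0) :
    ∃ r : ℝ, 0 < r ∧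
      ((proj f g e c - proj f g e b) / (proj f g e b - proj f g e a)).im = r * tri a b c := by
  have hdet := gram_det f g e a b c
  set z := proj f g e c - proj f g e b with hz
  set y := proj f g e b - proj f g e a with hy
  have key : z.im * y.re - z.re * y.im = tri f g e * tri a b c / (⟪e, a⟫ * ⟪e, b⟫ * ⟪e, c⟫) := by
    rw [← hdet, hz, hy]
    simp only [proj, Complex.sub_re, Complex.sub_im]
    field_simp
    ring
  have hy0 : 0 < Complex.normSq y := by
    rw [Complex.normSq_pos]
    intro h
    rw [h] at key
    simp only [Complex.zero_re, Complex.zero_im, mul_zero, sub_self] at key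
    have : tri f g e * tri a b c / (⟪e, a⟫ * ⟪e, b⟫ * ⟪e, c⟫) ≠ 0 :=
      div_ne_zero (mul_ne_zero hD.ne' ht) (by positivity)
    exact this key.symm
  refine ⟨tri f g e / (⟪e, a⟫ * ⟪e, b⟫ * ⟪e, c⟫) / Complex.normSq y, by positivity, ?_⟩
  rw [Complex.div_im, ← sub_div, key]
  ring

lemma eq_zero_of_inner {f g e z : E3} (hD : 0 < tri f g e) (h1 : ⟪f, z⟫ = 0) (h2 : ⟪g, z⟫ = 0)
    (h3 : ⟪e, z⟫ = 0) : z = 0 := by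
  have h := dual_basis f g e z
  rw [real_inner_comm, h1, real_inner_comm, h2, real_inner_comm, h3] at h
  simp only [zero_smul, add_zero, smul_eq_zero] at h
  exact h.resolve_left hD.ne'

lemma proj_support {f g e x a : E3} (hD : 0 < tri f g e) (hx : x ≠ 0) (ha : 0 < ⟪e, a⟫)
    (hxa : ⟪x, a⟫ = 0) :
    ∃ c : ℂ, c ≠ 0 ∧ ∀ b : E3, 0 < ⟪e, b⟫ → 0 ≤ ⟪x, b⟫ →
      0 ≤ ((proj f g e b - proj f g e a) / c).re := by
  have hdual := dual_basis' f g e x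
  set α := ⟪x, cross3 g e⟫
  set β := ⟪x, cross3 e f⟫
  set γ := ⟪x, cross3 f g⟫
  have hin : ∀ b : E3, tri f g e * ⟪x, b⟫ = α * ⟪f, b⟫ + β * ⟪g, b⟫ + γ * ⟪e, b⟫ := by
    intro b
    have := congrArg (fun y : E3 => ⟪y, b⟫) hdual
    simpa only [inner_add_left, real_inner_smul_left] using this
  have hA := hin a
  rw [hxa, mul_zero] at hA
  have hc : (⟨α, β⟩ : ℂ) ≠ 0 := by
    intro h
    have h1 : α = 0 := congrArg Complex.re h
    have h2 : β = 0 := congrArg Complex.im h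
    rw [h1, h2] at hA
    have h3 : γ = 0 := by
      have : γ * ⟪e, a⟫ = 0 := by linarith
      exact (mul_eq_zero.1 this).resolve_right ha.ne'
    rw [h1, h2, h3] at hdual
    simp only [zero_smul, add_zero, smul_eq_zero] at hdual
    exact hx (hdual.resolve_left hD.ne')
  refine ⟨⟨α, β⟩, hc, fun b hb hxb => ?_⟩
  have hB := hin b
  rw [Complex.div_re, ← add_div]
  apply div_nonneg _ (Complex.normSq_nonneg _)
  have : (proj f g e b - proj f g e a).re * α + (proj f g e b - proj f g e a).im * β =
      tri f g e * ⟪x, b⟫ / ⟪e, b⟫ := by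
    rw [hB]
    simp only [proj, Complex.sub_re, Complex.sub_im]
    field_simp
    linear_combination ⟪e, b⟫ * hA
  simp only
  rw [this]
  positivity

/-- Orientation at the vertex `k`. -/
def orient (v : E3) (w : ZMod n → E3) (k : ZMod n) : ℝ :=
  tri (w (k - 1) - v) (w k - v) (w (k + 1) - v)

lemma orient_ne_zero {v : E3} {w : ZMod n → E3} (hstar : IsStar v w) (k : ZMod n) :
    orient v w k ≠ 0 := by
  have := tri_ne_zero hstar (k - 1)
  rwa [sub_add_cancel] at this

lemma orient_same [NeZero n] {v : E3} {w : ZMod n → E3} (hstar : IsStar v w) {e : E3}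
    (he : ∀ j, 0 < ⟪e, w j - v⟫) {a b : ZMod n} {x y : E3} (hx : x ≠ 0) (hy : y ≠ 0)
    (hxD : ∀ j, 0 ≤ ⟪x, w j - v⟫) (hyD : ∀ j, 0 ≤ ⟪y, w j - v⟫)
    (hxa : ⟪x, w a - v⟫ = 0) (hyb : ⟪y, w b - v⟫ = 0) (ha : 0 < orient v w a) :
    0 < orient v w b := by
  -- choose a frame
  obtain ⟨f, g, hD⟩ : ∃ f g : E3, 0 < tri f g e := by
    refine ⟨starFN v w 0, cross3 e (starFN v w 0), ?_⟩
    have hm : starFN v w 0 ≠ 0 := cross_ne_zero (hstar.2.1 0)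
    have hm0 : ⟪starFN v w 0, w 0 - v⟫ = 0 := by
      rw [starFN, inner3]; simp only [cross3_0, cross3_1, cross3_2]; ring
    have h1 : tri (starFN v w 0) (cross3 e (starFN v w 0)) e =
        ⟪cross3 e (starFN v w 0), cross3 e (starFN v w 0)⟫ := by
      simp only [tri_eq, inner3, cross3_0, cross3_1, cross3_2]; ring
    rw [h1, real_inner_self_pos]
    apply cross_ne_zero
    rw [LinearIndependent.pair_iff]
    intro s t hst
    have h2 := congrArg (fun z : E3 => ⟪z, w 0 - v⟫) hst
    simp only [inner_add_left, real_inner_smul_left, hm0, inner_zero_left, mul_zero,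
      add_zero] at h2
    have hs : s = 0 := (mul_eq_zero.1 h2).resolve_right (he 0).ne'
    rw [hs, zero_smul, zero_add, smul_eq_zero] at hst
    exact ⟨hs, hst.resolve_right hm⟩
  set q : ZMod n → ℂ := fun j => proj f g e (w j - v) with hq
  have hturn : ∀ i, ∃ r : ℝ, 0 < r ∧ (turnC q i).im = r * orient v w i := fun i =>
    proj_turn hD (he _) (he _) (he _) (orient_ne_zero hstar i)
  have H2 : ∀ i, (turnC q i).im ≠ 0 := by
    intro i
    obtain ⟨r, hr, h⟩ := hturn i
    rw [h]
    exact mul_ne_zero hr.ne' (orient_ne_zero hstar i)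
  have H1 : ∀ i j : ZMod n, i ≠ j → j ≠ i + 1 → i ≠ j + 1 →
      Disjoint (segment ℝ (q i) (q (i + 1))) (segment ℝ (q j) (q (j + 1))) := by
    intro i j h1 h2 h3
    rw [Set.disjoint_left]
    rintro p ⟨s, t, hs, ht, hst, hp⟩ ⟨s', t', hs', ht', hst', hp'⟩
    have hpp := hp.trans hp'.symm
    have hre := congrArg Complex.re hpp
    have him := congrArg Complex.im hpp
    simp only [hq, proj, Complex.add_re, Complex.add_im, Complex.real_smul, Complex.re_ofReal_mul,
      Complex.im_ofReal_mul] at hre him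
    have e1 := he i
    have e2 := he (i + 1)
    have e3 := he j
    have e4 := he (j + 1)
    have hz := eq_zero_of_inner (f := f) (g := g) (e := e)
      (z := (s / ⟪e, w i - v⟫) • (w i - v) + (t / ⟪e, w (i + 1) - v⟫) • (w (i + 1) - v) -
        ((s' / ⟪e, w j - v⟫) • (w j - v) + (t' / ⟪e, w (j + 1) - v⟫) • (w (j + 1) - v))) hD
      (by
        rw [inner_sub_right, inner_add_right, inner_add_right]
        simp only [real_inner_smul_right]
        linear_combination hre)
      (by
        rw [inner_sub_right, inner_add_right, inner_add_right]
        simp only [real_inner_smul_right]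
        linear_combination him)
      (by
        rw [inner_sub_right, inner_add_right, inner_add_right]
        simp only [real_inner_smul_right]
        rw [div_mul_cancel₀ _ e1.ne', div_mul_cancel₀ _ e2.ne', div_mul_cancel₀ _ e3.ne',
          div_mul_cancel₀ _ e4.ne']
        linarith)
    have h0 := cone_disj hstar h1 h2 h3 (by positivity) (by positivity) (by positivity)
      (by positivity) (sub_eq_zero.1 hz)
    have h5 := congrArg (fun z : E3 => ⟪e, z⟫) h0
    simp only [inner_add_right, real_inner_smul_right, inner_zero_right] at h5
    rw [div_mul_cancel₀ _ e1.ne', div_mul_cancel₀ _ e2.ne'] at h5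
    linarith
  obtain ⟨c, hc, hcs⟩ := proj_support hD hx (he a) hxa
  obtain ⟨d, hd, hds⟩ := proj_support hD hy (he b) hyb
  obtain ⟨r, hr, hra⟩ := hturn a
  obtain ⟨r', hr', hrb⟩ := hturn b
  have := support_same hstar.1 q H1 H2 a b c d hc hd (fun j => hcs _ (he j) (hxD j))
    (fun j => hds _ (he j) (hyD j)) (by rw [hra]; positivity)
  rw [hrb] at this
  exact pos_of_mul_pos_right this hr'.le

end Support

section Wrap

variable {n : ℕ}

lemma starFN_eq {v : E3} {w : ZMod n → E3} (hstar : IsStar v w) (i : ZMod n) :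
    starFN v w i = ‖starFN v w i‖ • starUN v w i := by
  have : starFN v w i ≠ 0 := cross_ne_zero (hstar.2.1 i)
  rw [starUN, smul_smul, mul_inv_cancel₀ (norm_ne_zero_iff.2 this), one_smul]

lemma un_self {v : E3} {w : ZMod n → E3} (i : ZMod n) : ⟪starUN v w i, w i - v⟫ = 0 := by
  rw [starUN, real_inner_smul_left, starFN, inner3]
  simp only [cross3_0, cross3_1, cross3_2]; ring

lemma un_succ {v : E3} {w : ZMod n → E3} (i : ZMod n) : ⟪starUN v w i, w (i + 1) - v⟫ = 0 := by
  rw [starUN, real_inner_smul_left, starFN, inner3]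
  simp only [cross3_0, cross3_1, cross3_2]; ring

lemma un_succ_succ {v : E3} {w : ZMod n → E3} (i : ZMod n) :
    ⟪starUN v w i, w (i + 1 + 1) - v⟫ = ‖starFN v w i‖⁻¹ * orient v w (i + 1) := by
  rw [starUN, real_inner_smul_left, starFN, inner3, orient, tri_eq, add_sub_cancel_right]
  simp only [cross3_0, cross3_1, cross3_2]; ring

lemma un_pred {v : E3} {w : ZMod n → E3} (i : ZMod n) :
    ⟪starUN v w (i + 1), w i - v⟫ = ‖starFN v w (i + 1)‖⁻¹ * orient v w (i + 1) := by
  rw [starUN, real_inner_smul_left, starFN, inner3, orient, tri_eq, add_sub_cancel_right]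
  simp only [cross3_0, cross3_1, cross3_2]; ring

lemma norm_inv_pos {v : E3} {w : ZMod n → E3} (hstar : IsStar v w) (i : ZMod n) :
    0 < ‖starFN v w i‖⁻¹ :=
  inv_pos.2 (norm_pos_iff.2 (cross_ne_zero (hstar.2.1 i)))

/-- A supporting plane at the vertex `k` lies on the Gauss arc of this vertex. -/
lemma mem_arc {v : E3} {w : ZMod n → E3} (hstar : IsStar v w) {ε : ℝ} (hε : ε * ε = 1)
    {k : ZMod n} {x : E3} (hxD : ∀ j, 0 ≤ ⟪x, w j - v⟫) (hxk : ⟪x, w k - v⟫ = 0)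
    (ho : 0 < ε * orient v w k) :
    ∃ s r : ℝ, 0 ≤ s ∧ 0 ≤ r ∧ ε • x = s • starUN v w (k - 1) + r • starUN v w k := by
  have h := dual_basis (w (k - 1) - v) (w k - v) (w (k + 1) - v) x
  have hm1 : cross3 (w (k - 1) - v) (w k - v) = ‖starFN v w (k - 1)‖ • starUN v w (k - 1) := by
    rw [← starFN_eq hstar, starFN, sub_add_cancel]
  have hm2 : cross3 (w k - v) (w (k + 1) - v) = ‖starFN v w k‖ • starUN v w k := by
    rw [← starFN_eq hstar, starFN]
  rw [hxk, zero_smul, add_zero, hm1, hm2] at h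
  change orient v w k • x = _ at h
  refine ⟨(ε * orient v w k)⁻¹ * (⟪x, w (k + 1) - v⟫ * ‖starFN v w (k - 1)‖),
    (ε * orient v w k)⁻¹ * (⟪x, w (k - 1) - v⟫ * ‖starFN v w k‖), ?_, ?_, ?_⟩
  · have := hxD (k + 1); positivity
  · have := hxD (k - 1); positivity
  · have h2 : (ε * orient v w k) • (ε • x) = orient v w k • x := by
      rw [smul_smul]; congr 1; linear_combination orient v w k * hε
    rw [← inv_smul_smul₀ ho.ne' (ε • x), h2, h]
    module

/-- One gift-wrapping step. -/
lemma wrap_step [NeZero n] {v : E3} {w : ZMod n → E3} (hstar : IsStar v w) (hG : GaussEmb v w)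
    {ε : ℝ} (hε : ε * ε = 1)
    (hsup : ∀ (k : ZMod n) (x : E3), x ≠ 0 → (∀ j, 0 ≤ ⟪x, w j - v⟫) → ⟪x, w k - v⟫ = 0 →
      0 < ε * orient v w k)
    (i : ZMod n) {x : E3} (hx : x ≠ 0) (hxD : ∀ j, 0 ≤ ⟪x, w j - v⟫) {s r : ℝ} (hs : 0 ≤ s)
    (hr : 0 ≤ r) (hxe : ε • x = s • starUN v w i + r • starUN v w (i + 1)) :
    ∀ j, 0 ≤ ⟪ε • starUN v w (i + 1), w j - v⟫ := by
  have hε0 : ε ≠ 0 := by rintro rfl; simp at hε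
  have hxx : x = ε • (s • starUN v w i + r • starUN v w (i + 1)) := by
    rw [← hxe, smul_smul, hε, one_smul]
  set b : E3 := ε • starUN v w (i + 1) with hb
  rcases hs.eq_or_lt with hs0 | hs0
  · intro j
    have h1 : x = r • b := by rw [hxx, ← hs0, hb]; module
    have hr0 : 0 < r := by
      rcases hr.eq_or_lt with h | h
      · exfalso; apply hx; rw [h1, ← h, zero_smul]
      · exact h
    have h2 := hxD j
    rw [h1, real_inner_smul_left] at h2
    exact nonneg_of_mul_nonneg_right h2 hr0
  by_contra! hcon
  obtain ⟨j0, hj0⟩ := hcon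
  classical
  obtain ⟨k, hk, hkmin⟩ := Finset.exists_min_image
    (Finset.univ.filter fun j : ZMod n => ⟪b, w j - v⟫ < 0)
    (fun j => ⟪x, w j - v⟫ / (-⟪b, w j - v⟫)) ⟨j0, by simpa using hj0⟩
  simp only [Finset.mem_filter, Finset.mem_univ, true_and] at hk hkmin
  set l := ⟪x, w k - v⟫ / (-⟪b, w k - v⟫) with hl
  have hl0 : 0 ≤ l := div_nonneg (hxD k) (by linarith)
  set y := x + l • b with hy
  have hyD : ∀ j, 0 ≤ ⟪y, w j - v⟫ := by
    intro j
    rw [hy, inner_add_left, real_inner_smul_left]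
    rcases lt_or_ge ⟪b, w j - v⟫ 0 with h | h
    · have h1 := hkmin j h
      rw [le_div_iff₀ (by linarith)] at h1
      linarith
    · have := hxD j; positivity
  have hyk : ⟪y, w k - v⟫ = 0 := by
    rw [hy, inner_add_left, real_inner_smul_left, hl]
    have : ⟪b, w k - v⟫ ≠ 0 := hk.ne
    field_simp
    ring
  have hye : ε • y = s • starUN v w i + (r + l) • starUN v w (i + 1) := by
    rw [hy, smul_add, hxe, hb, smul_smul, smul_smul,
      show ε * l * ε = l by linear_combination l * hε]
    module
  have hy0 : y ≠ 0 := by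
    intro h
    have h1 := congrArg (fun z : E3 => ⟪z, w (i + 1 + 1) - v⟫) hye
    simp only [h, smul_zero, inner_zero_left, inner_add_left, real_inner_smul_left, un_succ,
      un_succ_succ, mul_zero, add_zero] at h1
    have h2 := norm_inv_pos hstar i
    exact mul_ne_zero hs0.ne' (mul_ne_zero h2.ne' (orient_ne_zero hstar (i + 1))) h1.symm
  have hxi : ⟪x, w (i + 1) - v⟫ = 0 := by
    rw [hxx, real_inner_smul_left, inner_add_left, real_inner_smul_left, real_inner_smul_left,
      un_succ, un_self]
    ring
  have hoi := hsup (i + 1) x hx hxD hxi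
  have hok := hsup k y hy0 hyD hyk
  have k1 : k ≠ i + 1 := by
    rintro rfl
    rw [hb, real_inner_smul_left, un_self] at hk; simp at hk
  have k2 : k ≠ i + 1 + 1 := by
    rintro rfl
    rw [hb, real_inner_smul_left, un_succ] at hk; simp at hk
  have k3 : k ≠ i := by
    rintro rfl
    rw [hb, real_inner_smul_left, un_pred] at hk
    have := mul_pos (norm_inv_pos hstar (k + 1)) hoi
    linarith
  obtain ⟨s', r', hs', hr', hye'⟩ := mem_arc hstar hε hyD hyk hok
  have h0 := gauss_disj hG (i := i) (j := k - 1) (fun h => k1 (by rw [h]; ring))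
    (fun h => k2 (by rw [← h]; ring)) (fun h => k3 (by rw [h]; ring)) hs (add_nonneg hr hl0)
    hs' hr' (by rw [sub_add_cancel, ← hye, hye'])
  rw [← hye, smul_eq_zero] at h0
  exact hy0 (h0.resolve_left hε0)

end Wrap

/-- Claim following Proposition 2.13: for an embedded, immersed simplicial vertex star
with non-self-intersecting Gauss image and positive discrete Gaussian curvature, the
Gauss image is contained in an open hemisphere. -/
theorem stmt8 {n : ℕ} [NeZero n] (v : E3) (w : ZMod n → E3)
    (hstar : IsStar v w) (hG : GaussEmb v w) (hK : 0 < curv v w) :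
    ∃ ν : E3, ‖ν‖ = 1 ∧ ∀ i : ZMod n, 0 < ⟪starUN v w i, ν⟫ := by
  have hsum : ∑ i, InnerProductGeometry.angle (w i - v) (w (i + 1) - v) < 2 * Real.pi := by
    rw [curv] at hK; linarith
  obtain ⟨e, he⟩ := exists_hemisphere (fun i => w i - v) hstar.2.1 hsum
  -- a first supporting plane
  obtain ⟨k0, -, hk0⟩ := Finset.exists_min_image (Finset.univ : Finset (ZMod n))
    (fun j => ⟪starUN v w 0, w j - v⟫ / ⟪e, w j - v⟫) ⟨0, Finset.mem_univ _⟩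
  set l := ⟪starUN v w 0, w k0 - v⟫ / ⟪e, w k0 - v⟫ with hl
  set x := starUN v w 0 - l • e with hx
  have hxD : ∀ j, 0 ≤ ⟪x, w j - v⟫ := by
    intro j
    have h1 := hk0 j (Finset.mem_univ _)
    rw [le_div_iff₀ (he j)] at h1
    rw [hx, inner_sub_left, real_inner_smul_left]
    linarith
  have hxk : ⟪x, w k0 - v⟫ = 0 := by
    rw [hx, inner_sub_left, real_inner_smul_left, hl, div_mul_cancel₀ _ (he k0).ne', sub_self]
  have hx0 : x ≠ 0 := by
    intro h
    have h1 : ⟪x, w 0 - v⟫ = 0 := by rw [h, inner_zero_left]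
    rw [hx, inner_sub_left, real_inner_smul_left, un_self] at h1
    have h2 : l = 0 := by
      have : l * ⟪e, w 0 - v⟫ = 0 := by linarith
      exact (mul_eq_zero.1 this).resolve_right (he 0).ne'
    rw [hx, h2, zero_smul, sub_zero] at h
    have h3 := starUN_norm hstar 0
    rw [h, norm_zero] at h3
    exact zero_ne_one h3
  -- global orientation sign
  obtain ⟨ε, hε, hsup⟩ : ∃ ε : ℝ, ε * ε = 1 ∧ ∀ (k : ZMod n) (x : E3), x ≠ 0 →
      (∀ j, 0 ≤ ⟪x, w j - v⟫) → ⟪x, w k - v⟫ = 0 → 0 < ε * orient v w k := by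
    rcases lt_or_gt_of_ne (orient_ne_zero hstar k0) with h | h
    · refine ⟨-1, by norm_num, fun k y hy hyD hyk => ?_⟩
      rcases lt_or_gt_of_ne (orient_ne_zero hstar k) with h' | h'
      · linarith
      · exact absurd (orient_same hstar he hy hx0 hyD hxD hyk hxk h') (by linarith)
    · refine ⟨1, by norm_num, fun k y hy hyD hyk => ?_⟩
      rw [one_mul]
      exact orient_same hstar he hx0 hy hxD hyD hxk hyk h
  have hε0 : ε ≠ 0 := by rintro rfl; simp at hε
  have hb0 : ∀ i, ε • starUN v w i ≠ 0 := by
    intro i h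
    rw [smul_eq_zero] at h
    have h3 := starUN_norm hstar i
    rw [h.resolve_left hε0, norm_zero] at h3
    exact zero_ne_one h3
  -- all face normals are supporting
  have hstep : ∀ i, (∀ j, 0 ≤ ⟪ε • starUN v w i, w j - v⟫) →
      ∀ j, 0 ≤ ⟪ε • starUN v w (i + 1), w j - v⟫ := by
    intro i hi
    exact wrap_step hstar hG hε hsup i (hb0 i) hi zero_le_one le_rfl (by
      rw [smul_smul, hε]; module)
  obtain ⟨s, r, hs, hr, hse⟩ := mem_arc hstar hε hxD hxk (hsup k0 x hx0 hxD hxk)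
  have hfirst := wrap_step hstar hG hε hsup (k0 - 1) hx0 hxD hs hr (by rwa [sub_add_cancel])
  rw [sub_add_cancel] at hfirst
  have hall' : ∀ m : ℕ, ∀ j, 0 ≤ ⟪ε • starUN v w (k0 + m), w j - v⟫ := by
    intro m
    induction m with
    | zero => simpa using hfirst
    | succ m ih =>
      have := hstep _ ih
      rw [Nat.cast_succ, ← add_assoc]
      exact this
  have hall : ∀ i j, 0 ≤ ε * ⟪starUN v w i, w j - v⟫ := by
    intro i j
    have := hall' (i - k0).val j
    rw [ZMod.natCast_zmod_val, add_sub_cancel, real_inner_smul_left] at this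
    exact this
  -- the interior direction
  set ν0 : E3 := ε • ∑ j, (w j - v) with hν0
  have hpos : ∀ i, 0 < ⟪starUN v w i, ν0⟫ := by
    intro i
    rw [hν0, real_inner_smul_right, inner_sum, Finset.mul_sum]
    refine Finset.sum_pos' (fun j _ => hall i j) ⟨i + 1 + 1, Finset.mem_univ _, ?_⟩
    refine lt_of_le_of_ne (hall i _) (Ne.symm ?_)
    rw [un_succ_succ]
    exact mul_ne_zero hε0 (mul_ne_zero (norm_inv_pos hstar i).ne' (orient_ne_zero hstar _))
  have hν : ν0 ≠ 0 := by
    intro h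
    have := hpos 0
    rw [h, inner_zero_right] at this
    exact lt_irrefl _ this
  refine ⟨‖ν0‖⁻¹ • ν0, ?_, fun i => ?_⟩
  · rw [norm_smul, norm_inv, norm_norm, inv_mul_cancel₀ (norm_ne_zero_iff.2 hν)]
  · rw [real_inner_smul_right]
    exact mul_pos (inv_pos.2 (norm_pos_iff.2 hν)) (hpos i)
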